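/- Let f = (f₁, f₂) : ℝ² → ℝ² be a C² map with det Df(z) ≠ 0 for every z ∈ ℝ², let z₀ ∈ ℝ² satisfy f(z₀) = (0,0), and suppose that H_f = (f₁² + f₂²)/2 is a polynomial function. Let W be the period annulus of z₀ (the maximal open connected set containing z₀ such that every point of W \ {z₀} lies on a periodic solution of ∇H_f^⊥ contained in W). If W ≠ ℝ², then the frontier ∂W of W is nonempty and unbounded, and ∂W contains no singular point of ∇H_f^⊥ (no point z with ∇H_f(z) = (0,0)). -/

import Mathlib

open Real Set

/-- Partial derivative in the `x` direction. -/
noncomputable def pdx (g : ℝ × ℝ → ℝ) (z : ℝ × ℝ) : ℝ := fderiv ℝ g z (1, 0)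

/-- Partial derivative in the `y` direction. -/
noncomputable def pdy (g : ℝ × ℝ → ℝ) (z : ℝ × ℝ) : ℝ := fderiv ℝ g z (0, 1)

/-- The Hamiltonian `H_f = (f₁² + f₂²)/2`. -/
noncomputable def Ham (f : ℝ × ℝ → ℝ × ℝ) (z : ℝ × ℝ) : ℝ :=
  ((f z).1 ^ 2 + (f z).2 ^ 2) / 2

/-- The Hamiltonian vector field `∇H_f^⊥ = (−∂H_f/∂y, ∂H_f/∂x)`. -/
noncomputable def hamVF (f : ℝ × ℝ → ℝ × ℝ) (z : ℝ × ℝ) : ℝ × ℝ :=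
  (-(pdy (Ham f) z), pdx (Ham f) z)

/-- The Jacobian determinant `det Df = ∂f₁/∂x ∂f₂/∂y − ∂f₂/∂x ∂f₁/∂y`. -/
noncomputable def jacDet (f : ℝ × ℝ → ℝ × ℝ) (z : ℝ × ℝ) : ℝ :=
  pdx (fun w => (f w).1) z * pdy (fun w => (f w).2) z -
    pdx (fun w => (f w).2) z * pdy (fun w => (f w).1) z

/-- `γ` is a periodic solution of the vector field `X` whose image is contained in `S`:
a non-constant `C¹` curve solving `γ' = X ∘ γ` with some period `T > 0`. -/
def IsPeriodicSolOn (X : ℝ × ℝ → ℝ × ℝ) (S : Set (ℝ × ℝ)) (γ : ℝ → ℝ × ℝ) : Prop :=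
  (∀ t, γ t ∈ S) ∧ (∀ t, HasDerivAt γ (X (γ t)) t) ∧
    (∃ T > 0, ∀ t, γ (t + T) = γ t) ∧ ∃ t s, γ t ≠ γ s

/-- The Euclidean norm on `ℝ²`. -/
noncomputable def euclNorm (w : ℝ × ℝ) : ℝ := Real.sqrt (w.1 ^ 2 + w.2 ^ 2)

/-- The open Euclidean disc of radius `r` centered at the origin. -/
def disc (r : ℝ) : Set (ℝ × ℝ) := {w | euclNorm w < r}

/-- `W` is the period annulus of the singular point `z₀` of the vector field `X` on `U`:
the maximal open connected subset of `U` containing `z₀` all whose points other than `z₀`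
lie on periodic solutions of `X` contained in `W`. -/
def IsPeriodAnnulus (X : ℝ × ℝ → ℝ × ℝ) (U : Set (ℝ × ℝ)) (z₀ : ℝ × ℝ)
    (W : Set (ℝ × ℝ)) : Prop :=
  z₀ ∈ W ∧ W ⊆ U ∧ IsOpen W ∧ IsConnected W ∧
    (∀ z ∈ W \ {z₀}, ∃ γ, IsPeriodicSolOn X W γ ∧ γ 0 = z) ∧
    ∀ W', z₀ ∈ W' → W' ⊆ U → IsOpen W' → IsConnected W' →
      (∀ z ∈ W' \ {z₀}, ∃ γ, IsPeriodicSolOn X W' γ ∧ γ 0 = z) → W ⊆ W' → W' = W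

section LocalSection

open Filter Topology Metric

variable {E : Type*} [TopologicalSpace E] {F : E → ℂ} {z₀ : E} {D : Set ℂ} {g : ℂ → E}

/-- `g` is a continuous right inverse of `F` on `D` with `g 0 = z₀`. -/
structure IsSectionOn (F : E → ℂ) (z₀ : E) (D : Set ℂ) (g : ℂ → E) : Prop where
  continuousOn : ContinuousOn g D
  right_inv : ∀ w ∈ D, F (g w) = w
  map_zero : g 0 = z₀

theorem IsSectionOn.mono {D' : Set ℂ} (hg : IsSectionOn F z₀ D g) (h : D' ⊆ D) :
    IsSectionOn F z₀ D' g :=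
  ⟨hg.continuousOn.mono h, fun w hw => hg.right_inv w (h hw), hg.map_zero⟩

theorem IsSectionOn.eqOn [T2Space E] (hF : IsLocalHomeomorph F) {g' : ℂ → E}
    (hg : IsSectionOn F z₀ D g) (hg' : IsSectionOn F z₀ D g') (hD : IsPreconnected D)
    (h0 : (0 : ℂ) ∈ D) : EqOn g g' D :=
  (T2Space.isSeparatedMap F).eqOn_of_comp_eqOn hF.isLocallyInjective hD hg.continuousOn
    hg'.continuousOn (fun w hw => (hg.right_inv w hw).trans (hg'.right_inv w hw).symm) h0
    (hg.map_zero.trans hg'.map_zero.symm)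

theorem exists_isSectionOn_ball (hF : IsLocalHomeomorph F) (h0 : F z₀ = 0) :
    ∃ r > 0, ∃ g, IsSectionOn F z₀ (ball 0 r) g := by
  obtain ⟨e, hz, rfl⟩ := hF z₀
  obtain ⟨r, hr, hb⟩ := Metric.isOpen_iff.1 e.open_target 0 (h0 ▸ e.map_source hz)
  exact ⟨r, hr, e.symm, e.continuousOn_symm.mono hb, fun w hw => e.right_inv (hb hw),
    h0 ▸ e.left_inv hz⟩

theorem exists_isSectionOn_of_forall_ball [T2Space E] (hF : IsLocalHomeomorph F) :
    ∃ G : ℂ → E, ∀ D : Set ℂ, 0 ∈ D →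
      (∀ w ∈ D, ∃ r, ‖w‖ < r ∧ ∃ g, IsSectionOn F z₀ (ball 0 r) g) → IsSectionOn F z₀ D G := by
  classical
  let S : ℂ → (ℂ → E) → Prop := fun w g => ∃ r, ‖w‖ < r ∧ IsSectionOn F z₀ (ball 0 r) g
  let G : ℂ → E := fun w => if h : ∃ g, S w g then h.choose w else z₀
  have key : ∀ r g, IsSectionOn F z₀ (ball 0 r) g → EqOn G g (ball 0 r) := by
    intro r g hg w hw
    have hw' : ‖w‖ < r := by simpa using hw
    have h : ∃ g, S w g := ⟨g, r, hw', hg⟩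
    obtain ⟨r', hr', hg'⟩ := h.choose_spec
    have hGw : G w = h.choose w := dif_pos h
    rw [hGw]
    have hmin : ‖w‖ < min r' r := lt_min hr' hw'
    refine (hg'.mono (ball_subset_ball (min_le_left r' r))).eqOn hF
      (hg.mono (ball_subset_ball (min_le_right r' r))) (convex_ball _ _).isPreconnected
      (mem_ball_self ((norm_nonneg w).trans_lt hmin)) (by simpa using hmin)
  refine ⟨G, fun D h0 h => ⟨fun w hw => ?_, fun w hw => ?_, ?_⟩⟩
  · obtain ⟨r, hr, g, hg⟩ := h w hw
    have hwr : ball (0 : ℂ) r ∈ 𝓝 w := isOpen_ball.mem_nhds (by simpa using hr)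
    exact (((hg.continuousOn.congr (key r g hg))).continuousAt hwr).continuousWithinAt
  · obtain ⟨r, hr, g, hg⟩ := h w hw
    have hwr : w ∈ ball (0 : ℂ) r := by simpa using hr
    rw [key r g hg hwr, hg.right_inv w hwr]
  · obtain ⟨r, hr, g, hg⟩ := h 0 h0
    rw [key r g hg (by simpa using hr), hg.map_zero]

theorem exists_maximal_isSectionOn [T2Space E] (hF : IsLocalHomeomorph F) (h0 : F z₀ = 0) :
    ∃ g D, IsSectionOn F z₀ D g ∧ (D = univ ∨ ∃ R > 0, D = ball 0 R ∧
      ∀ ρ > R, ∀ g', ¬ IsSectionOn F z₀ (ball 0 ρ) g') := by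
  obtain ⟨G, hG⟩ := exists_isSectionOn_of_forall_ball (z₀ := z₀) hF
  obtain ⟨r₀, hr₀, g₀, hg₀⟩ := exists_isSectionOn_ball hF h0
  let A : Set ℝ := {r | ∃ g, IsSectionOn F z₀ (ball 0 r) g}
  by_cases hA : BddAbove A
  · have hR : 0 < sSup A := hr₀.trans_le (le_csSup hA ⟨g₀, hg₀⟩)
    refine ⟨G, ball 0 (sSup A), hG _ (mem_ball_self hR) fun w hw => ?_, Or.inr ⟨sSup A, hR, rfl,
      fun ρ hρ g' hg' => hρ.not_ge (le_csSup hA ⟨g', hg'⟩)⟩⟩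
    obtain ⟨r, hr, hwr⟩ :=
      exists_lt_of_lt_csSup (s := A) ⟨r₀, g₀, hg₀⟩ (mem_ball_zero_iff.1 hw)
    exact ⟨r, hwr, hr⟩
  · refine ⟨G, univ, hG _ (mem_univ _) fun w _ => ?_, Or.inl rfl⟩
    obtain ⟨r, hr, hwr⟩ := not_bddAbove_iff.1 hA ‖w‖
    exact ⟨r, hwr, hr⟩

theorem IsSectionOn.isOpen_image (hF : IsLocalHomeomorph F) (hD : IsOpen D)
    (hg : IsSectionOn F z₀ D g) : IsOpen (g '' D) := by
  rw [isOpen_iff_mem_nhds]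
  rintro _ ⟨w, hw, rfl⟩
  obtain ⟨e, he, rfl⟩ := hF (g w)
  have hgc : ContinuousAt g (e (g w)) := by
    rw [hg.right_inv w hw]
    exact hg.continuousOn.continuousAt (hD.mem_nhds hw)
  have hc : ContinuousAt (g ∘ e) (g w) := hgc.comp hF.continuous.continuousAt
  have h1 : ∀ᶠ z in 𝓝 (g w), g (e z) ∈ e.source :=
    hc (by simpa [hg.right_inv w hw] using e.open_source.mem_nhds he)
  have h2 : ∀ᶠ z in 𝓝 (g w), e z ∈ D :=
    hF.continuous.continuousAt (by simpa [hg.right_inv w hw] using hD.mem_nhds hw)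
  filter_upwards [h1, h2, e.open_source.mem_nhds he] with z hz1 hz2 hz3
  exact ⟨e z, hz2, e.injOn hz1 hz3 (hg.right_inv _ hz2)⟩

theorem IsSectionOn.apply_of_mem_closure [T2Space E] (hF : Continuous F) (hD : IsOpen D)
    (hg : IsSectionOn F z₀ D g) {z : E} (hz : z ∈ closure (g '' D)) (hzD : F z ∈ D) :
    g (F z) = z := by
  have : (𝓝[g '' D] z).NeBot := mem_closure_iff_nhdsWithin_neBot.1 hz
  have hc : ContinuousAt (fun z => g (F z)) z :=
    ContinuousAt.comp (hg.continuousOn.continuousAt (hD.mem_nhds hzD)) hF.continuousAt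
  refine tendsto_nhds_unique (hc.mono_left nhdsWithin_le_nhds : Tendsto _ (𝓝[g '' D] z) _)
    ((tendsto_id.mono_left nhdsWithin_le_nhds).congr' ?_)
  filter_upwards [self_mem_nhdsWithin] with y hy
  obtain ⟨w, hw, rfl⟩ := hy
  simp [hg.right_inv w hw]

/-- At a point in the closure of the image of `g`, a local inverse of `F` agrees with `g`. -/
theorem IsSectionOn.exists_local_inverse [T2Space E] (hF : IsLocalHomeomorph F) (hD : Convex ℝ D)
    (hg : IsSectionOn F z₀ D g) {z : E} (hz : z ∈ closure (g '' D)) :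
    ∃ e : OpenPartialHomeomorph E ℂ, z ∈ e.source ∧ F = e ∧ ∃ δ > 0, ball (F z) δ ⊆ e.target ∧
      EqOn e.symm g (ball (F z) δ ∩ D) := by
  obtain ⟨e, he, rfl⟩ := hF z
  obtain ⟨δ, hδ, hb⟩ := Metric.isOpen_iff.1 e.open_target _ (e.map_source he)
  refine ⟨e, he, rfl, δ, hδ, hb, ?_⟩
  have hU : e.source ∩ e ⁻¹' ball (e z) δ ∈ 𝓝 z :=
    inter_mem (e.open_source.mem_nhds he)
      (hF.continuous.continuousAt (ball_mem_nhds _ hδ))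
  obtain ⟨_, ⟨hps, hpb⟩, p, hp, rfl⟩ := mem_closure_iff_nhds.1 hz _ hU
  have hpb' : p ∈ ball (e z) δ := by simpa only [mem_preimage, hg.right_inv p hp] using hpb
  refine (T2Space.isSeparatedMap e).eqOn_of_comp_eqOn hF.isLocallyInjective
    ((convex_ball _ _).inter hD).isPreconnected
    (e.continuousOn_symm.mono (inter_subset_left.trans hb))
    (hg.continuousOn.mono inter_subset_right) (fun w hw => ?_) ⟨hpb', hp⟩ ?_
  · exact (e.right_inv (hb hw.1)).trans (hg.right_inv w hw.2).symm
  · rw [← e.left_inv hps, hg.right_inv p hp]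

theorem IsSectionOn.tendsto_of_mem_closure [T2Space E] (hF : IsLocalHomeomorph F)
    (hD : Convex ℝ D) (hg : IsSectionOn F z₀ D g) {z : E} (hz : z ∈ closure (g '' D)) :
    Tendsto g (𝓝[D] F z) (𝓝 z) := by
  obtain ⟨e, he, rfl, δ, hδ, hb, heq⟩ := hg.exists_local_inverse hF hD hz
  have hc : Tendsto e.symm (𝓝 (e z)) (𝓝 z) := e.tendsto_symm he
  refine (hc.mono_left nhdsWithin_le_nhds).congr' ?_
  filter_upwards [self_mem_nhdsWithin, nhdsWithin_le_nhds (ball_mem_nhds _ hδ)] with w hw hw'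
    using heq ⟨hw', hw⟩

theorem IsSectionOn.eventually_mem_closure [T2Space E] (hF : IsLocalHomeomorph F)
    (hD : Convex ℝ D) (hg : IsSectionOn F z₀ D g) {z : E} (hz : z ∈ closure (g '' D)) :
    ∀ᶠ y in 𝓝 z, F y ∈ closure D → y ∈ closure (g '' D) := by
  obtain ⟨e, he, rfl, δ, hδ, hb, heq⟩ := hg.exists_local_inverse hF hD hz
  filter_upwards [e.open_source.mem_nhds he,
    hF.continuous.continuousAt (ball_mem_nhds (e z) hδ)] with y hy hyb hyD
  have h1 : e y ∈ closure (ball (e z) δ ∩ D) := isOpen_ball.inter_closure ⟨hyb, hyD⟩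
  have h2 := ContinuousWithinAt.mem_closure_image
    (e.continuousAt_symm (e.map_source hy)).continuousWithinAt h1
  rw [e.left_inv hy, heq.image_eq] at h2
  exact closure_mono (image_mono inter_subset_right) h2

/-- A section on a disc that extends to the boundary circle extends to a larger disc. -/
theorem IsSectionOn.exists_extension [T3Space E] (hF : IsLocalHomeomorph F) {R : ℝ} (hR : 0 < R)
    (hg : IsSectionOn F z₀ (ball 0 R) g)
    (h : ∀ q : ℂ, ‖q‖ = R → ∃ z ∈ closure (g '' ball 0 R), F z = q) :
    ∃ ρ > R, ∃ g', IsSectionOn F z₀ (ball 0 ρ) g' := by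
  have hcl : closure (ball (0 : ℂ) R) = closedBall 0 R := closure_ball _ hR.ne'
  have hlim : ∀ q ∈ closedBall (0 : ℂ) R, ∃ z, F z = q ∧ Tendsto g (𝓝[ball 0 R] q) (𝓝 z) := by
    intro q hq
    have hz : ∃ z ∈ closure (g '' ball 0 R), F z = q := by
      rcases (mem_closedBall_zero_iff.1 hq).lt_or_eq with hlt | heq
      · have hq' : q ∈ ball (0 : ℂ) R := mem_ball_zero_iff.2 hlt
        exact ⟨g q, subset_closure (mem_image_of_mem g hq'), hg.right_inv q hq'⟩
      · exact h q heq
    obtain ⟨z, hz, rfl⟩ := hz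
    exact ⟨z, rfl, hg.tendsto_of_mem_closure hF (convex_ball _ _) hz⟩
  set G := extendFrom (ball (0 : ℂ) R) g with hGdef
  have hGc : ContinuousOn G (closedBall 0 R) :=
    continuousOn_extendFrom hcl.ge fun q hq => (hlim q hq).imp fun _ => And.right
  have hGF : ∀ q ∈ closedBall (0 : ℂ) R, F (G q) = q := by
    intro q hq
    obtain ⟨z, hz, ht⟩ := hlim q hq
    rw [hGdef, extendFrom_eq (hcl.ge hq) ht, hz]
  have hG0 : G 0 = z₀ := by
    rw [hGdef, extendFrom_eq (subset_closure (mem_ball_self hR))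
      (hg.continuousOn 0 (mem_ball_self hR)), hg.map_zero]
  have hK : IsCompact (G '' closedBall 0 R) := (isCompact_closedBall _ _).image_of_continuousOn hGc
  have hinj : InjOn F (G '' closedBall 0 R) := by
    rintro _ ⟨p, hp, rfl⟩ _ ⟨q, hq, rfl⟩ hpq
    rw [hGF p hp, hGF q hq] at hpq
    rw [hpq]
  obtain ⟨t, ht, hKt, htinj⟩ := hinj.exists_isOpen_superset hK
    (fun x _ => hF.continuous.continuousAt) fun x _ => by
      obtain ⟨e, he, rfl⟩ := hF x
      exact ⟨e.source, e.open_source.mem_nhds he, e.injOn⟩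
  have hFt : IsOpen (F '' t) := hF.isOpenMap t ht
  have hsub : closedBall (0 : ℂ) R ⊆ F '' t := fun q hq =>
    ⟨G q, hKt (mem_image_of_mem G hq), hGF q hq⟩
  obtain ⟨ε, hε, hthick⟩ := (isCompact_closedBall (0 : ℂ) R).exists_thickening_subset_open hFt hsub
  rw [thickening_closedBall hε hR.le] at hthick
  have : Nonempty E := ⟨z₀⟩
  have hmem : ∀ w ∈ F '' t, Function.invFunOn F t w ∈ t := fun w hw => Function.invFunOn_mem hw
  have hval : ∀ w ∈ F '' t, F (Function.invFunOn F t w) = w := fun w hw =>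
    Function.invFunOn_eq hw
  have hz₀t : z₀ ∈ t := hKt ⟨0, mem_closedBall_self hR.le, hG0⟩
  have hFz₀ : F z₀ = 0 := by rw [← hG0, hGF 0 (mem_closedBall_self hR.le)]
  refine ⟨ε + R, by linarith, Function.invFunOn F t, fun w hw => ?_,
    fun w hw => hval w (hthick hw), ?_⟩
  · have hwt := hthick hw
    refine ContinuousAt.continuousWithinAt fun U hU => mem_map.2 ?_
    have hUt : U ∩ t ∈ 𝓝 (Function.invFunOn F t w) := inter_mem hU (ht.mem_nhds (hmem w hwt))
    have := hF.isOpenMap.image_mem_nhds hUt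
    rw [hval w hwt] at this
    filter_upwards [this] with v hv
    obtain ⟨x, ⟨hxU, hxt⟩, rfl⟩ := hv
    rwa [mem_preimage, htinj (hmem _ ⟨x, hxt, rfl⟩) hxt (hval _ ⟨x, hxt, rfl⟩)]
  · exact htinj (hmem 0 ⟨z₀, hz₀t, hFz₀⟩) hz₀t ((hval 0 ⟨z₀, hz₀t, hFz₀⟩).trans hFz₀.symm)

end LocalSection

section PeriodicODE

open Filter Topology MeasureTheory

theorem forall_pos_or_forall_neg_of_continuous {b : ℝ → ℝ} (hb : Continuous b)
    (h0 : ∀ x, b x ≠ 0) : (∀ x, 0 < b x) ∨ ∀ x, b x < 0 := by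
  by_contra! h
  obtain ⟨⟨x, hx⟩, y, hy⟩ := h
  obtain ⟨z, hz⟩ := mem_range_of_exists_le_of_exists_ge hb ⟨x, hx⟩ ⟨y, hy⟩
  exact h0 z hz

theorem exists_surjective_primitive {b : ℝ → ℝ} (hb : Continuous b) (hpos : ∀ x, 0 < b x)
    {T : ℝ} (hT : 0 < T) (hper : Function.Periodic b T) :
    ∃ s : ℝ → ℝ, s 0 = 0 ∧ (∀ x, HasDerivAt s (b x) x) ∧ Function.Surjective s ∧
      ∀ x, s (x + T) = s x + s T := by
  have hint : ∀ t₁ t₂, IntervalIntegrable b volume t₁ t₂ := hb.intervalIntegrable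
  have hderiv : ∀ x, HasDerivAt (fun x => ∫ u in (0 : ℝ)..x, b u) (b x) x := fun x =>
    intervalIntegral.integral_hasDerivAt_right (hint 0 x)
      (hb.stronglyMeasurableAtFilter _ _) hb.continuousAt
  refine ⟨fun x => ∫ u in (0 : ℝ)..x, b u, intervalIntegral.integral_same, hderiv, ?_, fun x => ?_⟩
  · exact (continuous_iff_continuousAt.2 fun x => (hderiv x).continuousAt).surjective
      (hper.tendsto_atTop_intervalIntegral_of_pos' (hint 0 T) hpos hT)
      (hper.tendsto_atBot_intervalIntegral_of_pos' (hint 0 T) hpos hT)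
  · simpa using hper.intervalIntegral_add_eq_add 0 x hint

/-- A nowhere vanishing continuous function has a surjective primitive if it is periodic. -/
theorem exists_surjective_primitive_of_ne_zero {b : ℝ → ℝ} (hb : Continuous b)
    (h0 : ∀ x, b x ≠ 0) {T : ℝ} (hT : 0 < T) (hper : Function.Periodic b T) :
    ∃ s : ℝ → ℝ, s 0 = 0 ∧ (∀ x, HasDerivAt s (b x) x) ∧ Function.Surjective s := by
  rcases forall_pos_or_forall_neg_of_continuous hb h0 with hpos | hneg
  · obtain ⟨s, h1, h2, h3, -⟩ := exists_surjective_primitive hb hpos hT hper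
    exact ⟨s, h1, h2, h3⟩
  · obtain ⟨s, h1, h2, h3, -⟩ := exists_surjective_primitive hb.neg
      (fun x => neg_pos.2 (hneg x)) hT (fun x => congrArg Neg.neg (hper x))
    refine ⟨fun x => -s x, by simp [h1], fun x => by simpa using (h2 x).fun_neg, fun y => ?_⟩
    obtain ⟨x, hx⟩ := h3 (-y)
    exact ⟨x, by simp [hx]⟩

theorem exists_ode_solution_of_pos {a : ℝ → ℝ} (ha : Continuous a) (hpos : ∀ x, 0 < a x)
    {T : ℝ} (hT : 0 < T) (hper : Function.Periodic a T) :
    ∃ θ : ℝ → ℝ, θ 0 = 0 ∧ (∀ t, HasDerivAt θ (a (θ t)) t) ∧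
      ∃ τ > 0, ∀ t, θ (t + τ) = θ t + T := by
  obtain ⟨s, hs0, hs, hsurj, hsT⟩ := exists_surjective_primitive
    (ha.inv₀ fun x => (hpos x).ne') (fun x => inv_pos.2 (hpos x)) hT
    (fun x => congrArg Inv.inv (hper x))
  have hmono : StrictMono s := strictMono_of_deriv_pos fun x => by
    rw [(hs x).deriv]; exact inv_pos.2 (hpos x)
  let e := hmono.orderIsoOfSurjective s hsurj
  have hes : ∀ t, s (e.symm t) = t := fun t => e.apply_symm_apply t
  refine ⟨e.symm, hmono.injective (by rw [hes, hs0]), fun t => ?_, s T, ?_, fun t => ?_⟩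
  · simpa using HasDerivAt.of_local_left_inverse e.symm.continuous.continuousAt (hs (e.symm t))
      (inv_ne_zero (hpos _).ne') (Eventually.of_forall hes)
  · exact hs0 ▸ hmono hT
  · exact hmono.injective (by rw [hes, hsT, hes])

/-- An autonomous scalar equation with periodic nowhere vanishing right-hand side has a global
solution, which shifts by one period of the right-hand side in finite time. -/
theorem exists_ode_solution_of_ne_zero {a : ℝ → ℝ} (ha : Continuous a) (h0 : ∀ x, a x ≠ 0)
    {T : ℝ} (hT : 0 < T) (hper : Function.Periodic a T) :
    ∃ θ : ℝ → ℝ, θ 0 = 0 ∧ (∀ t, HasDerivAt θ (a (θ t)) t) ∧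
      ∃ τ > 0, ∀ t, θ t = θ (t + τ) + T ∨ θ (t + τ) = θ t + T := by
  rcases forall_pos_or_forall_neg_of_continuous ha h0 with hpos | hneg
  · obtain ⟨θ, h1, h2, τ, hτ, h3⟩ := exists_ode_solution_of_pos ha hpos hT hper
    exact ⟨θ, h1, h2, τ, hτ, fun t => Or.inr (h3 t)⟩
  · obtain ⟨θ, h1, h2, τ, hτ, h3⟩ := exists_ode_solution_of_pos (a := fun x => -a (-x))
      (by fun_prop) (fun x => neg_pos.2 (hneg _)) hT (fun x => by
        have := hper (-(x + T))
        simp only [neg_add, neg_add_cancel_right] at this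
        simp [add_comm (-T), this])
    exact ⟨fun t => -θ t, by simp [h1], fun t => by simpa using (h2 t).fun_neg, τ, hτ,
      fun t => Or.inl (by simp only [h3]; ring)⟩

/-- A complex curve rotating about the origin with periodic nowhere vanishing angular speed
covers its whole circle. -/
theorem exists_eq_of_rotating {ζ : ℝ → ℂ} {b : ℝ → ℝ} (hb : Continuous b) (h0 : ∀ x, b x ≠ 0)
    {T : ℝ} (hT : 0 < T) (hper : Function.Periodic b T)
    (hζ : ∀ t, HasDerivAt ζ (b t * (Complex.I * ζ t)) t) :
    (∀ t, ‖ζ t‖ = ‖ζ 0‖) ∧ ∀ q : ℂ, ‖q‖ = ‖ζ 0‖ → ∃ t, ζ t = q := by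
  obtain ⟨θ, hθ0, hθ, hsurj⟩ := exists_surjective_primitive_of_ne_zero hb h0 hT hper
  have hexp : ∀ t, HasDerivAt (fun t => ζ t * Complex.exp (-(θ t * Complex.I))) 0 t := by
    intro t
    have h1 : HasDerivAt (fun t => Complex.exp (-((θ t : ℂ) * Complex.I)))
        (Complex.exp (-(θ t * Complex.I)) * (-(b t * Complex.I))) t :=
      ((((hθ t).ofReal_comp).mul_const Complex.I).neg).cexp
    exact ((hζ t).fun_mul h1).congr_deriv (by ring)
  have hconst : ∀ t, ζ t * Complex.exp (-(θ t * Complex.I)) = ζ 0 := by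
    intro t
    have := is_const_of_deriv_eq_zero (fun t => (hexp t).differentiableAt)
      (fun t => (hexp t).deriv) t 0
    simpa [hθ0] using this
  have hζt : ∀ t, ζ t = ζ 0 * Complex.exp (θ t * Complex.I) := by
    intro t
    rw [← hconst t, mul_assoc, ← Complex.exp_add]
    simp
  have hnorm : ∀ t, ‖ζ t‖ = ‖ζ 0‖ := fun t => by
    rw [hζt t, norm_mul, Complex.norm_exp_ofReal_mul_I, mul_one]
  refine ⟨hnorm, fun q hq => ?_⟩
  by_cases hz : ζ 0 = 0
  · exact ⟨0, by rw [hz]; rw [hz, norm_zero, norm_eq_zero] at hq; exact hq.symm⟩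
  · obtain ⟨t, ht⟩ := hsurj (q / ζ 0).arg
    refine ⟨t, ?_⟩
    have h1 : ‖q / ζ 0‖ = 1 := by
      rw [norm_div, hq, div_self (norm_ne_zero_iff.2 hz)]
    have := Complex.norm_mul_exp_arg_mul_I (q / ζ 0)
    rw [h1, Complex.ofReal_one, one_mul] at this
    rw [hζt, ht, this, mul_div_cancel₀ _ hz]

end PeriodicODE

section PeriodAnnulus

open Filter Topology Metric

/-- `F` is a local diffeomorphism carrying the vector field `X` to rotation about the origin with
angular speed `d`. -/
structure CarriesToRotation (F : ℝ × ℝ → ℂ) (X : ℝ × ℝ → ℝ × ℝ) (d : ℝ × ℝ → ℝ) : Prop where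
  continuous : Continuous d
  ne_zero : ∀ z, d z ≠ 0
  exists_deriv : ∀ z, ∃ L : (ℝ × ℝ) ≃L[ℝ] ℂ, HasStrictFDerivAt F (L : ℝ × ℝ →L[ℝ] ℂ) z ∧
    L (X z) = d z * (Complex.I * F z)

variable {F : ℝ × ℝ → ℂ} {X : ℝ × ℝ → ℝ × ℝ} {d : ℝ × ℝ → ℝ} {z₀ : ℝ × ℝ}
  {W : Set (ℝ × ℝ)} {D : Set ℂ} {g : ℂ → ℝ × ℝ}

theorem CarriesToRotation.isLocalHomeomorph (h : CarriesToRotation F X d) :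
    IsLocalHomeomorph F := by
  intro z
  obtain ⟨L, hL, -⟩ := h.exists_deriv z
  exact ⟨hL.toOpenPartialHomeomorph F, hL.mem_toOpenPartialHomeomorph_source, rfl⟩

theorem CarriesToRotation.hasDerivAt_comp (h : CarriesToRotation F X d) {γ : ℝ → ℝ × ℝ} {t : ℝ}
    (hγ : HasDerivAt γ (X (γ t)) t) :
    HasDerivAt (F ∘ γ) (d (γ t) * (Complex.I * F (γ t))) t := by
  obtain ⟨L, hL, hX⟩ := h.exists_deriv (γ t)
  rw [← hX]
  exact hL.hasFDerivAt.comp_hasDerivAt t hγ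

theorem CarriesToRotation.apply_eq_zero_iff (h : CarriesToRotation F X d) {z : ℝ × ℝ} :
    X z = 0 ↔ F z = 0 := by
  obtain ⟨L, -, hX⟩ := h.exists_deriv z
  rw [← L.map_eq_zero_iff, hX]
  simp [h.ne_zero z]

/-- A periodic orbit covers the whole circle on which its image under `F` lies. -/
theorem CarriesToRotation.norm_eq_and_exists_eq (h : CarriesToRotation F X d)
    {γ : ℝ → ℝ × ℝ} (hγ : IsPeriodicSolOn X W γ) :
    (∀ t, ‖F (γ t)‖ = ‖F (γ 0)‖) ∧ ∀ q : ℂ, ‖q‖ = ‖F (γ 0)‖ → ∃ t, F (γ t) = q := by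
  obtain ⟨-, hd, ⟨T, hT, hper⟩, -⟩ := hγ
  have hc : Continuous γ := continuous_iff_continuousAt.2 fun t => (hd t).continuousAt
  exact exists_eq_of_rotating (ζ := F ∘ γ) (b := d ∘ γ) (h.continuous.comp hc)
    (fun _ => h.ne_zero _) hT (fun t => congrArg d (hper t)) fun t => h.hasDerivAt_comp (hd t)

/-- The image of a rotation invariant domain under a section consists of periodic orbits. -/
theorem CarriesToRotation.exists_isPeriodicSolOn (h : CarriesToRotation F X d)
    (hg : IsSectionOn F z₀ D g) (hD : IsOpen D) (hrot : ∀ w w' : ℂ, ‖w'‖ = ‖w‖ → w ∈ D → w' ∈ D)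
    {p : ℂ} (hp : p ∈ D) (hp0 : p ≠ 0) : ∃ γ, IsPeriodicSolOn X (g '' D) γ ∧ γ 0 = g p := by
  let φ : ℝ → ℂ := fun x => Complex.exp (x * Complex.I) * p
  have hφD : ∀ x, φ x ∈ D := fun x => hrot p _ (by simp [φ, Complex.norm_exp_ofReal_mul_I]) hp
  have hφ0 : φ 0 = p := by simp [φ]
  have hφ : ∀ x, HasDerivAt φ (Complex.I * φ x) x := fun x => by
    refine ((((hasDerivAt_id x).ofReal_comp).mul_const Complex.I).cexp.mul_const p).congr_deriv ?_
    simp only [φ, id_eq, Complex.ofReal_one, one_mul]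
    ring
  have hφper : Function.Periodic φ (2 * π) := fun x => by
    simp only [φ]
    rw [Complex.ofReal_add, add_mul, Complex.exp_add]
    simp [Complex.exp_two_pi_mul_I]
  have hφc : Continuous φ := continuous_iff_continuousAt.2 fun x => (hφ x).continuousAt
  have hgφ : Continuous (g ∘ φ) := hg.continuousOn.comp_continuous hφc hφD
  obtain ⟨θ, hθ0, hθ, τ, hτ, hθτ⟩ := exists_ode_solution_of_ne_zero
    (a := fun x => d (g (φ x))) (h.continuous.comp hgφ) (fun _ => h.ne_zero _) two_pi_pos
    (fun x => by simp only [hφper x])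
  have hderiv : ∀ t, HasDerivAt (fun t => g (φ (θ t))) (X (g (φ (θ t)))) t := by
    intro t
    obtain ⟨L, hL, hX⟩ := h.exists_deriv (g (φ (θ t)))
    have hDn : D ∈ 𝓝 (φ (θ t)) := hD.mem_nhds (hφD _)
    have hgL : HasFDerivAt g (L.symm : ℂ →L[ℝ] ℝ × ℝ) (φ (θ t)) :=
      HasFDerivAt.of_local_left_inverse (hg.continuousOn.continuousAt hDn) hL.hasFDerivAt
        (by filter_upwards [hDn] with w hw using hg.right_inv w hw)
    have h1 : HasDerivAt (fun t => φ (θ t)) (d (g (φ (θ t))) • (Complex.I * φ (θ t))) t :=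
      (hφ (θ t)).scomp t (hθ t)
    have h2 := hgL.comp_hasDerivAt t h1
    have h3 : L.symm (d (g (φ (θ t))) • (Complex.I * φ (θ t))) = X (g (φ (θ t))) := by
      rw [L.symm_apply_eq, hX, hg.right_inv _ (hφD _), Complex.real_smul]
    exact h3 ▸ h2
  have hstart : g (φ (θ 0)) = g p := by rw [hθ0, hφ0]
  refine ⟨fun t => g (φ (θ t)), ⟨fun t => mem_image_of_mem g (hφD _), hderiv,
    ⟨τ, hτ, fun t => ?_⟩, ?_⟩, hstart⟩
  · rcases hθτ t with ht | ht
    · simp only [ht, hφper _]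
    · simp only [ht, hφper _]
  · by_contra! hcon
    have hz : X (g (φ (θ 0))) = 0 :=
      (hderiv 0).unique ((hasDerivAt_const (0 : ℝ) (g (φ (θ 0)))).congr_of_eventuallyEq
        (Eventually.of_forall fun t => hcon t 0))
    rw [h.apply_eq_zero_iff, hstart, hg.right_inv p hp] at hz
    exact hp0 hz

/-- The image of a maximal section contains every connected set that contains `z₀` and is filled
by periodic orbits. -/
theorem CarriesToRotation.subset_image (h : CarriesToRotation F X d)
    (hg : IsSectionOn F z₀ D g) (h0 : (0 : ℂ) ∈ D)
    (hD : D = univ ∨ ∃ R > 0, D = ball 0 R ∧ ∀ ρ > R, ∀ g', ¬ IsSectionOn F z₀ (ball 0 ρ) g')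
    (hz₀ : z₀ ∈ W) (hW : IsPreconnected W)
    (hper : ∀ z ∈ W \ {z₀}, ∃ γ, IsPeriodicSolOn X W γ ∧ γ 0 = z) : W ⊆ g '' D := by
  have hF := h.isLocalHomeomorph
  have hDo : IsOpen D := by
    rcases hD with rfl | ⟨R, -, rfl, -⟩
    exacts [isOpen_univ, isOpen_ball]
  have hz₀V : z₀ ∈ g '' D := ⟨0, h0, hg.map_zero⟩
  refine hW.subset_of_closure_inter_subset (hg.isOpen_image hF hDo) ⟨z₀, hz₀, hz₀V⟩ ?_
  rintro z ⟨hz, hzW⟩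
  by_cases hzD : F z ∈ D
  · exact ⟨F z, hzD, hg.apply_of_mem_closure hF.continuous hDo hz hzD⟩
  rcases hD with rfl | ⟨R, hR, rfl, hmax⟩
  · exact absurd (mem_univ _) hzD
  exfalso
  have hcl : closure (ball (0 : ℂ) R) = closedBall 0 R := closure_ball _ hR.ne'
  have himg : F '' (g '' ball 0 R) ⊆ ball 0 R := by
    rintro _ ⟨_, ⟨w, hw, rfl⟩, rfl⟩
    rwa [hg.right_inv w hw]
  have hzcl : F z ∈ closedBall (0 : ℂ) R := by
    rw [← hcl]
    exact closure_mono himg (image_closure_subset_closure_image hF.continuous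
      (mem_image_of_mem F hz))
  have hzR : ‖F z‖ = R := le_antisymm (by simpa using hzcl) (by simpa using hzD)
  have hzz₀ : z ≠ z₀ := by
    rintro rfl
    exact hzD (himg (mem_image_of_mem F hz₀V))
  obtain ⟨γ, hγ, rfl⟩ := hper z ⟨hzW, hzz₀⟩
  obtain ⟨hnorm, hcover⟩ := h.norm_eq_and_exists_eq hγ
  have hc : Continuous γ := continuous_iff_continuousAt.2 fun t => (hγ.2.1 t).continuousAt
  have hclopen : IsClopen (γ ⁻¹' closure (g '' ball 0 R)) := by
    refine ⟨isClosed_closure.preimage hc, isOpen_iff_mem_nhds.2 fun t ht => ?_⟩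
    filter_upwards [hc.continuousAt
      (hg.eventually_mem_closure hF (convex_ball _ _) ht)] with s hs
    exact hs (by rw [hcl]; simp [hnorm s, hzR])
  have huniv := hclopen.eq_univ ⟨0, hz⟩
  obtain ⟨ρ, hρ, g', hg'⟩ := hg.exists_extension hF hR fun q hq => by
    obtain ⟨t, ht⟩ := hcover q (hq.trans hzR.symm)
    exact ⟨γ t, by simpa using huniv.ge (mem_univ t), ht⟩
  exact hmax ρ hρ g' hg'

/-- The period annulus is the image of a maximal section. -/
theorem CarriesToRotation.exists_periodAnnulus_eq_image (h : CarriesToRotation F X d)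
    (hz₀ : F z₀ = 0) (hW : IsPeriodAnnulus X univ z₀ W) :
    ∃ g D, IsSectionOn F z₀ D g ∧ W = g '' D ∧ (D = univ ∨ ∃ R > 0, D = ball 0 R ∧
      ∀ ρ > R, ∀ g', ¬ IsSectionOn F z₀ (ball 0 ρ) g') := by
  obtain ⟨hzW, -, hWo, hWc, hWper, hWmax⟩ := hW
  have hF := h.isLocalHomeomorph
  obtain ⟨g, D, hg, hD⟩ := exists_maximal_isSectionOn hF hz₀
  obtain ⟨h0, hDo, hDc, hrot⟩ : (0 : ℂ) ∈ D ∧ IsOpen D ∧ IsPreconnected D ∧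
      ∀ w w' : ℂ, ‖w'‖ = ‖w‖ → w ∈ D → w' ∈ D := by
    rcases hD with rfl | ⟨R, hR, rfl, -⟩
    · exact ⟨mem_univ _, isOpen_univ, isPreconnected_univ, fun _ _ _ _ => mem_univ _⟩
    · exact ⟨mem_ball_self hR, isOpen_ball, (convex_ball _ _).isPreconnected,
        fun w w' hw => by simp [hw]⟩
  refine ⟨g, D, hg, (h.subset_image hg h0 hD hzW hWc.isPreconnected hWper).antisymm ?_, hD⟩
  have hzV : z₀ ∈ g '' D := ⟨0, h0, hg.map_zero⟩
  have hVc : IsConnected (g '' D) := ⟨⟨z₀, hzV⟩, hDc.image g hg.continuousOn⟩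
  have := hWmax (W ∪ g '' D) (Or.inl hzW) (subset_univ _) (hWo.union (hg.isOpen_image hF hDo))
    (IsConnected.union ⟨z₀, hzW, hzV⟩ hWc hVc) ?_ subset_union_left
  · exact subset_union_right.trans this.le
  rintro z ⟨hz | ⟨p, hp, rfl⟩, hne⟩
  · obtain ⟨γ, hγ, hγz⟩ := hWper z ⟨hz, hne⟩
    exact ⟨γ, ⟨fun t => Or.inl (hγ.1 t), hγ.2⟩, hγz⟩
  · obtain ⟨γ, hγ, hγz⟩ := h.exists_isPeriodicSolOn hg hDo hrot hp (by
      rintro rfl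
      exact hne hg.map_zero)
    exact ⟨γ, ⟨fun t => Or.inr (hγ.1 t), hγ.2⟩, hγz⟩

theorem isPreconnected_compl_closedBall (M : ℝ) (hM : 0 ≤ M) :
    IsPreconnected (closedBall (0 : ℝ × ℝ) M)ᶜ := by
  have hS : IsPreconnected (sphere (0 : ℝ × ℝ) 1) :=
    isPreconnected_sphere (by simp [one_add_one_eq_two]) 0 1
  convert ((isPreconnected_Ioi (a := M)).prod hS).image (fun x : ℝ × (ℝ × ℝ) => x.1 • x.2)
    (by fun_prop) using 1
  ext z
  simp only [mem_compl_iff, mem_closedBall_zero_iff, not_le, mem_image, mem_prod, mem_Ioi,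
    mem_sphere_zero_iff_norm, Prod.exists]
  constructor
  · intro hz
    have hz0 : ‖z‖ ≠ 0 := (hM.trans_lt hz).ne'
    exact ⟨‖z‖, (‖z‖⁻¹ • z).1, (‖z‖⁻¹ • z).2, ⟨hz, by
      rw [Prod.mk.eta, norm_smul, norm_inv, norm_norm, inv_mul_cancel₀ hz0]⟩, by
      rw [Prod.mk.eta, smul_inv_smul₀ hz0]⟩
  · rintro ⟨t, a, b, ⟨ht, hab⟩, rfl⟩
    rw [norm_smul, hab, mul_one]
    exact ht.trans_le (le_abs_self t)

/-- The alternatives for the period annulus: it is the whole plane, or `F` avoids the origin on its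
frontier and, if the frontier is bounded, `F` is bounded. -/
theorem CarriesToRotation.frontier_periodAnnulus (h : CarriesToRotation F X d)
    (hz₀ : F z₀ = 0) (hW : IsPeriodAnnulus X univ z₀ W) :
    (∀ z ∈ frontier W, F z ≠ 0) ∧
      ((frontier W).Nonempty → Bornology.IsBounded (frontier W) → ∃ C, ∀ z, ‖F z‖ ≤ C) := by
  have hF := h.isLocalHomeomorph
  have hWo : IsOpen W := hW.2.2.1
  obtain ⟨g, D, hg, rfl, hD⟩ := h.exists_periodAnnulus_eq_image hz₀ hW
  have hDo : IsOpen D := by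
    rcases hD with rfl | ⟨R, -, rfl, -⟩
    exacts [isOpen_univ, isOpen_ball]
  have hfr : ∀ z ∈ frontier (g '' D), F z ∉ D := by
    intro z hz hzD
    rw [hWo.frontier_eq] at hz
    exact hz.2 ⟨F z, hzD, hg.apply_of_mem_closure hF.continuous hDo hz.1 hzD⟩
  rcases hD with rfl | ⟨R, hR, rfl, hmax⟩
  · exact ⟨fun z hz => absurd (mem_univ _) (hfr z hz),
      fun ⟨z, hz⟩ => absurd (mem_univ _) (hfr z hz)⟩
  refine ⟨fun z hz hz0 => hfr z hz (hz0 ▸ mem_ball_self hR), fun _ hb => ?_⟩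
  obtain ⟨M, hM0, hM⟩ : ∃ M, 0 ≤ M ∧ frontier (g '' ball 0 R) ⊆ closedBall 0 M := by
    obtain ⟨M, hM⟩ := hb.subset_closedBall 0
    exact ⟨max M 0, le_max_right _ _, hM.trans (closedBall_subset_closedBall (le_max_left _ _))⟩
  have hpre := isPreconnected_compl_closedBall M hM0
  by_cases hmeet : ((closedBall (0 : ℝ × ℝ) M)ᶜ ∩ g '' ball 0 R).Nonempty
  · have hsub : (closedBall (0 : ℝ × ℝ) M)ᶜ ⊆ g '' ball 0 R :=
      hpre.subset_of_closure_inter_subset hWo hmeet fun z hz => by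
        by_contra hzW
        exact hz.2 (hM (hWo.frontier_eq ▸ ⟨hz.1, hzW⟩))
    obtain ⟨C, hC⟩ := (isCompact_closedBall (0 : ℝ × ℝ) M).exists_bound_of_continuousOn
      hF.continuous.continuousOn
    refine ⟨max C R, fun z => ?_⟩
    by_cases hz : z ∈ closedBall (0 : ℝ × ℝ) M
    · exact (hC z hz).trans (le_max_left _ _)
    · obtain ⟨w, hw, rfl⟩ := hsub hz
      rw [hg.right_inv w hw]
      exact (mem_ball_zero_iff.1 hw).le.trans (le_max_right _ _)
  · exfalso
    have hsub : closure (g '' ball 0 R) ⊆ closedBall (0 : ℝ × ℝ) M :=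
      closure_minimal (fun z hz => by_contra fun hzM => hmeet ⟨z, hzM, hz⟩) isClosed_closedBall
    have hK : IsCompact (closure (g '' ball 0 R)) :=
      (isCompact_closedBall _ _).of_isClosed_subset isClosed_closure hsub
    have hFK : closedBall (0 : ℂ) R ⊆ F '' closure (g '' ball 0 R) := by
      rw [← closure_ball _ hR.ne']
      exact closure_minimal (fun w hw => ⟨g w, subset_closure (mem_image_of_mem g hw),
        hg.right_inv w hw⟩) (hK.image hF.continuous).isClosed
    obtain ⟨ρ, hρ, g', hg'⟩ := hg.exists_extension hF hR fun q hq =>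
      hFK (mem_closedBall_zero_iff.2 hq.le)
    exact hmax ρ hρ g' hg'

end PeriodAnnulus

theorem MvPolynomial.eval_eq_of_bounded {p : MvPolynomial (Fin 2) ℝ} {C : ℝ}
    (hp : ∀ v, |MvPolynomial.eval v p| ≤ C) (v w : Fin 2 → ℝ) :
    MvPolynomial.eval v p = MvPolynomial.eval w p := by
  let P : Polynomial ℝ := MvPolynomial.aeval
    (fun i => Polynomial.C (v i) + Polynomial.X * Polynomial.C (w i - v i)) p
  have hP : ∀ t, P.eval t = MvPolynomial.eval (fun i => v i + t * (w i - v i)) p := by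
    intro t
    rw [← Polynomial.coe_evalRingHom, MvPolynomial.map_aeval, MvPolynomial.eval]
    congr 1
    ext <;> simp
  have hdeg : P.degree ≤ 0 := by
    rw [← Polynomial.isBoundedUnder_abs_atTop_iff]
    exact Filter.isBoundedUnder_of ⟨C, fun t => by rw [hP]; exact hp _⟩
  rw [Polynomial.eq_C_of_degree_le_zero hdeg] at hP
  have h0 := hP 0
  have h1 := hP 1
  simp only [Polynomial.eval_C, zero_mul, add_zero, one_mul, add_sub_cancel] at h0 h1
  exact h0.symm.trans h1

section Hamiltonian

variable {f : ℝ × ℝ → ℝ × ℝ} {z : ℝ × ℝ}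

theorem pdx_fst (hf : DifferentiableAt ℝ f z) :
    pdx (fun w => (f w).1) z = (fderiv ℝ f z (1, 0)).1 := by
  rw [pdx, hf.hasFDerivAt.fst.fderiv]; rfl

theorem pdx_snd (hf : DifferentiableAt ℝ f z) :
    pdx (fun w => (f w).2) z = (fderiv ℝ f z (1, 0)).2 := by
  rw [pdx, hf.hasFDerivAt.snd.fderiv]; rfl

theorem pdy_fst (hf : DifferentiableAt ℝ f z) :
    pdy (fun w => (f w).1) z = (fderiv ℝ f z (0, 1)).1 := by
  rw [pdy, hf.hasFDerivAt.fst.fderiv]; rfl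

theorem pdy_snd (hf : DifferentiableAt ℝ f z) :
    pdy (fun w => (f w).2) z = (fderiv ℝ f z (0, 1)).2 := by
  rw [pdy, hf.hasFDerivAt.snd.fderiv]; rfl

theorem fderiv_Ham_apply (hf : DifferentiableAt ℝ f z) (v : ℝ × ℝ) :
    fderiv ℝ (Ham f) z v =
      (f z).1 * (fderiv ℝ f z v).1 + (f z).2 * (fderiv ℝ f z v).2 := by
  have h : HasFDerivAt (Ham f) _ z :=
    ((hf.hasFDerivAt.fst.pow 2).add (hf.hasFDerivAt.snd.pow 2)).mul_const (2⁻¹ : ℝ)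
  rw [h.fderiv]
  simp
  ring

theorem fderiv_apply_eq (z v : ℝ × ℝ) :
    fderiv ℝ f z v = v.1 • fderiv ℝ f z (1, 0) + v.2 • fderiv ℝ f z (0, 1) := by
  rw [← map_smul, ← map_smul, ← map_add]
  simp

theorem jacDet_eq (hf : DifferentiableAt ℝ f z) :
    jacDet f z = (fderiv ℝ f z (1, 0)).1 * (fderiv ℝ f z (0, 1)).2 -
      (fderiv ℝ f z (1, 0)).2 * (fderiv ℝ f z (0, 1)).1 := by
  rw [jacDet, pdx_fst hf, pdx_snd hf, pdy_fst hf, pdy_snd hf]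

theorem fderiv_injective_of_jacDet_ne_zero (hf : DifferentiableAt ℝ f z) (hdet : jacDet f z ≠ 0) :
    Function.Injective (fderiv ℝ f z) := by
  rw [injective_iff_map_eq_zero]
  intro v hv
  rw [jacDet_eq hf] at hdet
  rw [fderiv_apply_eq] at hv
  have h1 := congrArg Prod.fst hv
  have h2 := congrArg Prod.snd hv
  simp only [Prod.fst_add, Prod.snd_add, Prod.smul_fst, Prod.smul_snd, smul_eq_mul,
    Prod.fst_zero, Prod.snd_zero] at h1 h2
  have hv1 : v.1 * ((fderiv ℝ f z (1, 0)).1 * (fderiv ℝ f z (0, 1)).2 -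
      (fderiv ℝ f z (1, 0)).2 * (fderiv ℝ f z (0, 1)).1) = 0 := by
    linear_combination (fderiv ℝ f z (0, 1)).2 * h1 - (fderiv ℝ f z (0, 1)).1 * h2
  have hv2 : v.2 * ((fderiv ℝ f z (1, 0)).1 * (fderiv ℝ f z (0, 1)).2 -
      (fderiv ℝ f z (1, 0)).2 * (fderiv ℝ f z (0, 1)).1) = 0 := by
    linear_combination (fderiv ℝ f z (1, 0)).1 * h2 - (fderiv ℝ f z (1, 0)).2 * h1
  exact Prod.ext ((mul_eq_zero.1 hv1).resolve_right hdet)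
    ((mul_eq_zero.1 hv2).resolve_right hdet)

/-- `f` carries its Hamiltonian vector field to rotation with angular speed `det Df`. -/
theorem carriesToRotation_hamVF (hf : ContDiff ℝ 2 f) (hdet : ∀ z, jacDet f z ≠ 0) :
    CarriesToRotation (fun z => Complex.equivRealProdCLM.symm (f z)) (hamVF f) (jacDet f) := by
  have hdiff : Differentiable ℝ f := hf.differentiable (by norm_num)
  refine ⟨?_, hdet, fun z => ?_⟩
  · have hc : Continuous (fderiv ℝ f) := hf.continuous_fderiv (by norm_num)
    rw [show jacDet f = _ from funext fun z => jacDet_eq (hdiff z)]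
    fun_prop
  · have hinj := fderiv_injective_of_jacDet_ne_zero (hdiff z) (hdet z)
    let A : (ℝ × ℝ) ≃L[ℝ] ℝ × ℝ :=
      (LinearEquiv.ofInjectiveEndo (fderiv ℝ f z : ℝ × ℝ →ₗ[ℝ] ℝ × ℝ) hinj).toContinuousLinearEquiv
    have hA : ∀ v, A v = fderiv ℝ f z v := fun v => rfl
    refine ⟨A.trans Complex.equivRealProdCLM.symm, ?_, ?_⟩
    · exact Complex.equivRealProdCLM.symm.hasStrictFDerivAt.comp z
        (hf.contDiffAt.hasStrictFDerivAt (by norm_num))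
    · rw [ContinuousLinearEquiv.trans_apply, hA, fderiv_apply_eq, jacDet_eq (hdiff z)]
      simp only [hamVF, pdx, pdy, fderiv_Ham_apply (hdiff z)]
      apply Complex.ext
      · simp
        ring
      · simp
        ring

theorem norm_sq_eq_two_mul_Ham (f : ℝ × ℝ → ℝ × ℝ) (z : ℝ × ℝ) :
    ‖Complex.equivRealProdCLM.symm (f z)‖ ^ 2 = 2 * Ham f z := by
  rw [← Complex.normSq_eq_norm_sq, Complex.normSq_apply, Ham]
  simp
  ring

end Hamiltonian

theorem polynomial_case_frontier (f : ℝ × ℝ → ℝ × ℝ) (hf : ContDiff ℝ 2 f)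
    (hdet : ∀ z : ℝ × ℝ, jacDet f z ≠ 0)
    (z₀ : ℝ × ℝ) (hfz : f z₀ = (0, 0))
    (hpoly : ∃ p : MvPolynomial (Fin 2) ℝ, ∀ z : ℝ × ℝ,
      Ham f z = MvPolynomial.eval ![z.1, z.2] p)
    (W : Set (ℝ × ℝ)) (hW : IsPeriodAnnulus (hamVF f) Set.univ z₀ W)
    (hWne : W ≠ Set.univ) :
    (frontier W).Nonempty ∧ ¬Bornology.IsBounded (frontier W) ∧
      ∀ z ∈ frontier W, (pdx (Ham f) z, pdy (Ham f) z) ≠ ((0 : ℝ), (0 : ℝ)) := by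
  have h := carriesToRotation_hamVF hf hdet
  have hF₀ : Complex.equivRealProdCLM.symm (f z₀) = 0 := by
    rw [hfz]; exact map_zero Complex.equivRealProdCLM.symm
  obtain ⟨hne, hbdd⟩ := h.frontier_periodAnnulus hF₀ hW
  have hfr : (frontier W).Nonempty := nonempty_frontier_iff.2 ⟨⟨z₀, hW.1⟩, hWne⟩
  refine ⟨hfr, fun hb => ?_, fun z hz hgrad => ?_⟩
  · obtain ⟨C, hC⟩ := hbdd hfr hb
    obtain ⟨p, hp⟩ := hpoly
    obtain ⟨z₁, hz₁⟩ := hfr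
    have hH : ∀ v, |MvPolynomial.eval v p| ≤ C ^ 2 := fun v => by
      have hv : v = ![(v 0, v 1).1, (v 0, v 1).2] := by ext i; fin_cases i <;> rfl
      rw [hv, ← hp]
      have h1 := norm_sq_eq_two_mul_Ham f (v 0, v 1)
      have h2 : ‖Complex.equivRealProdCLM.symm (f (v 0, v 1))‖ ^ 2 ≤ C ^ 2 :=
        pow_le_pow_left₀ (norm_nonneg _) (hC _) 2
      rw [abs_le]
      constructor <;> nlinarith [sq_nonneg ‖Complex.equivRealProdCLM.symm (f (v 0, v 1))‖]
    have heq : Ham f z₁ = Ham f z₀ := by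
      rw [hp, hp]; exact MvPolynomial.eval_eq_of_bounded hH _ _
    refine hne z₁ hz₁ (norm_eq_zero.1 (pow_eq_zero_iff two_ne_zero |>.1 ?_))
    rw [norm_sq_eq_two_mul_Ham, heq, ← norm_sq_eq_two_mul_Ham, hF₀]
    simp
  · rw [Prod.mk.injEq] at hgrad
    exact hne z hz (h.apply_eq_zero_iff.1 (by simp [hamVF, hgrad]))
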